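/- There exist ε′ > 0 and C > 0, depending only on n, λ, Λ, such that for every short-geodesic trajectory with data (y₀, η₀, s) with 0 < s < ε′ one has, for all t ∈ [0,T]: ‖y(t) − y₀‖ ≤ C s², ‖η(t) − η₀‖ ≤ C s², |ξ(t)| ≤ s, and x(t) ≤ C s. -/

import Mathlib

open Set

noncomputable section

/-- `quadForm M v w = ⟨M v, w⟩`, the bilinear form of the matrix `M` with respect to the
standard inner product on `ℝ^m`. -/
def quadForm {m : ℕ} (M : Matrix (Fin m) (Fin m) ℝ) (v w : Fin m → ℝ) : ℝ :=
  ∑ i, (∑ j, M i j * v j) * w i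

/-- The Euclidean norm of a vector in `ℝ^m`. -/
def euclNorm {m : ℕ} (v : Fin m → ℝ) : ℝ :=
  Real.sqrt (∑ i, v i ^ 2)

/-- Entrywise partial derivative `∂ₓ A` of a matrix-valued map in its first (scalar) variable. -/
def dxA {m : ℕ} (A : ℝ → (Fin m → ℝ) → Matrix (Fin m) (Fin m) ℝ)
    (x : ℝ) (y : Fin m → ℝ) : Matrix (Fin m) (Fin m) ℝ :=
  Matrix.of fun i j => deriv (fun x' => A x' y i j) x

/-- Entrywise partial derivative `∂_{y k} A` of a matrix-valued map in the `k`-th component of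
its second (vector) variable. -/
def dyA {m : ℕ} (A : ℝ → (Fin m → ℝ) → Matrix (Fin m) (Fin m) ℝ)
    (k : Fin m) (x : ℝ) (y : Fin m → ℝ) : Matrix (Fin m) (Fin m) ℝ :=
  Matrix.of fun i j => deriv (fun s => A x (Function.update y k s) i j) (y k)

/-- Partial derivative `∂ₓ f` of a scalar function of `(x, y)`. -/
def dxF {m : ℕ} (f : ℝ → (Fin m → ℝ) → ℝ) (x : ℝ) (y : Fin m → ℝ) : ℝ :=
  deriv (fun x' => f x' y) x

/-- Partial derivative `∂_{y k} f` of a scalar function of `(x, y)`. -/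
def dyF {m : ℕ} (f : ℝ → (Fin m → ℝ) → ℝ) (k : Fin m) (x : ℝ) (y : Fin m → ℝ) : ℝ :=
  deriv (fun s => f x (Function.update y k s)) (y k)

/-- Iterated partial derivative `∂ₓ^k f` of a scalar function of `(x, y)`. -/
def dxIter {m : ℕ} : ℕ → (ℝ → (Fin m → ℝ) → ℝ) → ℝ → (Fin m → ℝ) → ℝ
  | 0, f => f
  | (k+1), f => dxF (dxIter k f)

/-- The standing hypotheses on the data of a gas giant in `g`-boundary normal coordinates:
`n ≥ 2`, `ε ∈ (0,1]`, `U ⊆ ℝ^{n-1}` open, and `A : [0,ε) × U → ℝ^{(n-1)×(n-1)}` symmetric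
positive definite (with uniform ellipticity constants `0 < lam ≤ Lam`), extending to a `C^∞`
map on an open neighborhood of `[0,ε) × U`, with all first-order partial derivatives of all
entries bounded by `Lam`.  (`A` plays the role of the inverse boundary metric `h^{ij}` of the
gas giant metric `g = dx² + x⁻² h(x,y,dy)`.) -/
structure GasGiantData (n : ℕ) (ε : ℝ) (U : Set (Fin (n-1) → ℝ))
    (A : ℝ → (Fin (n-1) → ℝ) → Matrix (Fin (n-1)) (Fin (n-1)) ℝ)
    (lam Lam : ℝ) : Prop where
  hn : 2 ≤ n
  hε : ε ∈ Set.Ioc (0:ℝ) 1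
  hU : IsOpen U
  hlam : 0 < lam
  hlamLam : lam ≤ Lam
  hsymm : ∀ x ∈ Set.Ico (0:ℝ) ε, ∀ y ∈ U, (A x y).IsSymm
  hsmooth : ∃ W : Set (ℝ × (Fin (n-1) → ℝ)), IsOpen W ∧ Set.Ico (0:ℝ) ε ×ˢ U ⊆ W ∧
    ∀ i j, ContDiffOn ℝ (⊤ : ℕ∞) (fun p : ℝ × (Fin (n-1) → ℝ) => A p.1 p.2 i j) W
  hposdef : ∀ x ∈ Set.Ico (0:ℝ) ε, ∀ y ∈ U, ∀ v : Fin (n-1) → ℝ,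
    lam * (∑ i, v i ^ 2) ≤ quadForm (A x y) v v ∧ quadForm (A x y) v v ≤ Lam * (∑ i, v i ^ 2)
  hderivBound : ∀ x ∈ Set.Ico (0:ℝ) ε, ∀ y ∈ U,
    (∀ i j, |dxA A x y i j| ≤ Lam) ∧ (∀ k i j, |dyA A k x y i j| ≤ Lam)

/-- A Hamiltonian trajectory on the interval `I` for the gas giant Hamiltonian
`H(x,y,ξ,η) = ½ ξ² + ½ x² ⟨A(x,y)η, η⟩`: a `C¹` curve
`t ↦ (x(t), y(t), ξ(t), η(t)) ∈ [0,ε) × U × ℝ × ℝ^{n-1}` satisfying Hamilton's equations. -/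
structure IsHamTraj (n : ℕ) (ε : ℝ) (U : Set (Fin (n-1) → ℝ))
    (A : ℝ → (Fin (n-1) → ℝ) → Matrix (Fin (n-1)) (Fin (n-1)) ℝ) (I : Set ℝ)
    (x : ℝ → ℝ) (y : ℝ → Fin (n-1) → ℝ) (ξ : ℝ → ℝ) (η : ℝ → Fin (n-1) → ℝ) : Prop where
  mem : ∀ t ∈ I, x t ∈ Set.Ico (0:ℝ) ε ∧ y t ∈ U
  hx : ∀ t ∈ I, HasDerivAt x (ξ t) t
  hy : ∀ t ∈ I, ∀ i, HasDerivAt (fun t' => y t' i)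
    ((x t)^2 * ∑ j, A (x t) (y t) i j * η t j) t
  hxi : ∀ t ∈ I, HasDerivAt ξ
    (-(x t * quadForm (A (x t) (y t)) (η t) (η t))
      - (1/2) * (x t)^2 * quadForm (dxA A (x t) (y t)) (η t) (η t)) t
  heta : ∀ t ∈ I, ∀ i, HasDerivAt (fun t' => η t' i)
    (-(1/2) * (x t)^2 * quadForm (dyA A i (x t) (y t)) (η t) (η t)) t

/-- A short-geodesic trajectory with data `(y₀, η₀, s)`: a Hamiltonian trajectory on `[0,T]`,
`T > 0`, with initial value `(0, y₀, s, η₀)`, with `x(T) = 0` and `x(t) > 0` on `(0,T)`. -/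
def IsShortGeo (n : ℕ) (ε : ℝ) (U : Set (Fin (n-1) → ℝ))
    (A : ℝ → (Fin (n-1) → ℝ) → Matrix (Fin (n-1)) (Fin (n-1)) ℝ)
    (y₀ η₀ : Fin (n-1) → ℝ) (s T : ℝ)
    (x : ℝ → ℝ) (y : ℝ → Fin (n-1) → ℝ) (ξ : ℝ → ℝ) (η : ℝ → Fin (n-1) → ℝ) : Prop :=
  0 < T ∧ IsHamTraj n ε U A (Set.Icc 0 T) x y ξ η ∧
    x 0 = 0 ∧ y 0 = y₀ ∧ ξ 0 = s ∧ η 0 = η₀ ∧ x T = 0 ∧ ∀ t ∈ Set.Ioo 0 T, 0 < x t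

section QuadForm

variable {m : ℕ}

lemma quadForm_comm {M : Matrix (Fin m) (Fin m) ℝ} (hM : M.IsSymm) (v w : Fin m → ℝ) :
    quadForm M v w = quadForm M w v := by
  simp only [quadForm, Finset.sum_mul]
  rw [Finset.sum_comm]
  refine Finset.sum_congr rfl fun i _ => Finset.sum_congr rfl fun j _ => ?_
  rw [← hM.apply i j]
  ring

lemma quadForm_add_smul (M : Matrix (Fin m) (Fin m) ℝ) (v w : Fin m → ℝ) (c : ℝ) :
    quadForm M (v + c • w) (v + c • w) =
      quadForm M v v + c * quadForm M v w + c * quadForm M w v + c ^ 2 * quadForm M w w := by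
  simp only [quadForm, Finset.mul_sum, Finset.sum_mul, ← Finset.sum_add_distrib]
  refine Finset.sum_congr rfl fun i _ => Finset.sum_congr rfl fun j _ => ?_
  simp only [Pi.add_apply, Pi.smul_apply, smul_eq_mul]
  ring

lemma quadForm_single (M : Matrix (Fin m) (Fin m) ℝ) (v : Fin m → ℝ) (i : Fin m) :
    quadForm M v (Pi.single i 1) = ∑ j, M i j * v j := by
  simp [quadForm, Pi.single_apply]

lemma sum_single_sq (i : Fin m) : ∑ j, (Pi.single i (1 : ℝ) : Fin m → ℝ) j ^ 2 = 1 := by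
  simp [Pi.single_apply]

lemma abs_quadForm_le {M : Matrix (Fin m) (Fin m) ℝ} {L : ℝ} (hM : ∀ i j, |M i j| ≤ L)
    (v : Fin m → ℝ) : |quadForm M v v| ≤ L * m * ∑ i, v i ^ 2 := by
  have hcs : (∑ i, |v i|) ^ 2 ≤ m * ∑ i, v i ^ 2 := by
    simpa using sq_sum_le_card_mul_sum_sq (s := Finset.univ) (f := fun i => |v i|)
  have hle : |quadForm M v v| ≤ L * (∑ i, |v i|) ^ 2 := by
    rw [sq, Finset.sum_mul_sum]
    simp only [quadForm, Finset.sum_mul, Finset.mul_sum]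
    refine (Finset.abs_sum_le_sum_abs _ _).trans (Finset.sum_le_sum fun i _ => ?_)
    refine (Finset.abs_sum_le_sum_abs _ _).trans (Finset.sum_le_sum fun j _ => ?_)
    rw [abs_mul, abs_mul, mul_assoc, mul_comm |v j|]
    exact mul_le_mul_of_nonneg_right (hM i j) (by positivity)
  rcases Nat.eq_zero_or_pos m with rfl | hm
  · simp [quadForm]
  · have hL : 0 ≤ L := (abs_nonneg _).trans (hM ⟨0, hm⟩ ⟨0, hm⟩)
    calc |quadForm M v v| ≤ L * (∑ i, |v i|) ^ 2 := hle
      _ ≤ L * (m * ∑ i, v i ^ 2) := mul_le_mul_of_nonneg_left hcs hL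
      _ = _ := by ring

lemma abs_mulVec_apply_le {M : Matrix (Fin m) (Fin m) ℝ} (hM : M.IsSymm) {L : ℝ}
    (hpos : ∀ v, 0 ≤ quadForm M v v) (hL : ∀ v : Fin m → ℝ, quadForm M v v ≤ L * ∑ i, v i ^ 2)
    (v : Fin m → ℝ) (i : Fin m) :
    |∑ j, M i j * v j| ≤ L / 2 * (∑ j, v j ^ 2 + 1) := by
  rw [← quadForm_single]
  have h1 := hpos (v + (1 : ℝ) • Pi.single i 1)
  have h2 := hpos (v + (-1 : ℝ) • Pi.single i 1)
  have h3 := hL v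
  have h4 := hL (Pi.single i 1)
  rw [quadForm_add_smul, quadForm_comm hM (Pi.single i 1) v] at h1 h2
  rw [sum_single_sq] at h4
  rw [abs_le]
  constructor <;> linarith

lemma euclNorm_le_of_abs_le {v : Fin m → ℝ} {B : ℝ} (hB : 0 ≤ B) (hv : ∀ i, |v i| ≤ B) :
    euclNorm v ≤ m * B := by
  refine Real.sqrt_le_iff.2 ⟨by positivity, ?_⟩
  calc ∑ i, v i ^ 2 ≤ ∑ _i : Fin m, B ^ 2 :=
        Finset.sum_le_sum fun i _ => sq_le_sq.2 (by rw [abs_of_nonneg hB]; exact hv i)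
    _ = m * B ^ 2 := by simp
    _ ≤ (m * m) * B ^ 2 := by
        refine mul_le_mul_of_nonneg_right ?_ (sq_nonneg B)
        exact_mod_cast Nat.le_mul_self m
    _ = (m * B) ^ 2 := by ring

lemma half_sum_sq_le {v w : Fin m → ℝ} {B : ℝ} (h : ∀ i, |v i - w i| ≤ B) :
    (∑ i, w i ^ 2) / 2 - m * B ^ 2 ≤ ∑ i, v i ^ 2 := by
  have key : ∀ i, w i ^ 2 / 2 - B ^ 2 ≤ v i ^ 2 := fun i => by
    have := sq_le_sq' (abs_le.1 (h i)).1 (abs_le.1 (h i)).2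
    nlinarith [sq_nonneg (2 * v i - w i)]
  have := Finset.sum_le_sum fun i (_ : i ∈ Finset.univ) => key i
  rw [Finset.sum_sub_distrib, ← Finset.sum_div] at this
  simpa using this

lemma hasDerivAt_quadForm {M : ℝ → Matrix (Fin m) (Fin m) ℝ} {M' : Matrix (Fin m) (Fin m) ℝ}
    {v : ℝ → Fin m → ℝ} {v' : Fin m → ℝ} {t : ℝ}
    (hM : ∀ i j, HasDerivAt (fun t => M t i j) (M' i j) t)
    (hv : ∀ i, HasDerivAt (fun t => v t i) (v' i) t) :
    HasDerivAt (fun t => quadForm (M t) (v t) (v t))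
      (quadForm M' (v t) (v t) + quadForm (M t) v' (v t) + quadForm (M t) (v t) v') t := by
  have := HasDerivAt.fun_sum (u := Finset.univ) fun i _ =>
    (HasDerivAt.fun_sum (u := Finset.univ) fun j _ => (hM i j).fun_mul (hv j)).fun_mul (hv i)
  refine this.congr_deriv ?_
  simp only [quadForm, ← Finset.sum_add_distrib]
  refine Finset.sum_congr rfl fun i _ => ?_
  simp only [Finset.sum_add_distrib]
  ring

lemma hasDerivAt_comp_partials {F : ℝ × (Fin m → ℝ) → ℝ} {x : ℝ → ℝ} {y : ℝ → Fin m → ℝ}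
    {x' : ℝ} {y' : Fin m → ℝ} {t : ℝ} (hF : DifferentiableAt ℝ F (x t, y t))
    (hx : HasDerivAt x x' t) (hy : ∀ i, HasDerivAt (fun t => y t i) (y' i) t) :
    HasDerivAt (fun t => F (x t, y t))
      (x' * deriv (fun a => F (a, y t)) (x t) +
        ∑ k, y' k * deriv (fun a => F (x t, Function.update (y t) k a)) (y t k)) t := by
  have hy' : HasDerivAt y y' t := hasDerivAt_pi.2 hy
  have hchain : HasDerivAt (fun t => F (x t, y t)) (fderiv ℝ F (x t, y t) (x', y')) t :=
    hF.hasFDerivAt.comp_hasDerivAt t (hx.prodMk hy')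
  have hdx : HasDerivAt (fun a => F (a, y t)) (fderiv ℝ F (x t, y t) (1, 0)) (x t) :=
    hF.hasFDerivAt.comp_hasDerivAt (x t) ((hasDerivAt_id (x t)).prodMk (hasDerivAt_const _ _))
  have hdy : ∀ k, HasDerivAt (fun a => F (x t, Function.update (y t) k a))
      (fderiv ℝ F (x t, y t) (0, Pi.single k 1)) (y t k) := fun k => by
    have hF' : HasFDerivAt F (fderiv ℝ F (x t, y t))
        (x t, Function.update (y t) k (y t k)) := by
      rw [Function.update_eq_self]; exact hF.hasFDerivAt
    exact hF'.comp_hasDerivAt (y t k)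
      ((hasDerivAt_const _ _).prodMk (hasDerivAt_update (y t) k (y t k)))
  refine hchain.congr_deriv ?_
  rw [hdx.deriv]
  simp only [fun k => (hdy k).deriv]
  have hdecomp : ((x', y') : ℝ × (Fin m → ℝ)) =
      x' • (1, 0) + ∑ k, y' k • ((0, Pi.single k 1) : ℝ × (Fin m → ℝ)) := by
    refine Prod.ext ?_ ?_
    · simp [Prod.fst_sum]
    · ext i
      simp [Prod.snd_sum, Finset.sum_apply, Pi.single_apply]
  conv_lhs => rw [hdecomp]
  simp only [map_add, map_smul, map_sum, smul_eq_mul]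

end QuadForm

lemma abs_sub_le_of_hasDerivAt {f f' : ℝ → ℝ} {T B : ℝ}
    (hf : ∀ t ∈ Icc 0 T, HasDerivAt f (f' t) t) (hB : ∀ t ∈ Icc 0 T, |f' t| ≤ B)
    {t : ℝ} (ht : t ∈ Icc 0 T) : |f t - f 0| ≤ B * t := by
  have := (convex_Icc 0 T).norm_image_sub_le_of_norm_hasDerivWithin_le
    (fun u hu => (hf u hu).hasDerivWithinAt) hB ⟨le_rfl, ht.1.trans ht.2⟩ ht
  simpa [Real.norm_eq_abs, abs_of_nonneg ht.1] using this

/-- Sturm comparison with the harmonic oscillator of frequency `w`. -/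
lemma nonpos_of_deriv_le_neg_sq_mul {x ξ ξ' : ℝ → ℝ} {w : ℝ} (hw : 0 < w)
    (hx : ∀ t ∈ Icc 0 (Real.pi / w), HasDerivAt x (ξ t) t)
    (hξ : ∀ t ∈ Icc 0 (Real.pi / w), HasDerivAt ξ (ξ' t) t)
    (hx0 : x 0 = 0) (hle : ∀ t ∈ Icc 0 (Real.pi / w), ξ' t ≤ -(w ^ 2 * x t)) :
    x (Real.pi / w) ≤ 0 := by
  have hP : 0 ≤ Real.pi / w := div_nonneg Real.pi_pos.le hw.le
  have hd : ∀ t ∈ Icc 0 (Real.pi / w), HasDerivAt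
      (fun t => ξ t * Real.sin (w * t) - w * (x t * Real.cos (w * t)))
      ((ξ' t + w ^ 2 * x t) * Real.sin (w * t)) t := fun t ht => by
    have hl : HasDerivAt (fun t => w * t) w t := by simpa using (hasDerivAt_id t).const_mul w
    refine (((hξ t ht).mul hl.sin).sub (((hx t ht).mul hl.cos).const_mul w)).congr_deriv ?_
    ring
  have hanti : AntitoneOn (fun t => ξ t * Real.sin (w * t) - w * (x t * Real.cos (w * t)))
      (Icc 0 (Real.pi / w)) := by
    refine antitoneOn_of_deriv_nonpos (convex_Icc _ _)
      (fun t ht => (hd t ht).continuousAt.continuousWithinAt)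
      (fun t ht => (hd t (interior_subset ht)).differentiableAt.differentiableWithinAt)
      fun t ht => ?_
    have ht' := interior_subset ht
    rw [(hd t ht').deriv]
    refine mul_nonpos_of_nonpos_of_nonneg (by linarith [hle t ht'])
      (Real.sin_nonneg_of_nonneg_of_le_pi (mul_nonneg hw.le ht'.1) ?_)
    have := mul_le_mul_of_nonneg_left ht'.2 hw.le
    rwa [mul_div_cancel₀ _ hw.ne'] at this
  have h := hanti ⟨le_rfl, hP⟩ ⟨hP, le_rfl⟩ hP
  simp only [mul_div_cancel₀ _ hw.ne', hx0, mul_zero, Real.sin_zero, Real.sin_pi, Real.cos_pi,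
    zero_mul, sub_zero, zero_sub] at h
  nlinarith

section Trajectory

variable {n : ℕ} {ε : ℝ} {U : Set (Fin (n-1) → ℝ)}
  {A : ℝ → (Fin (n-1) → ℝ) → Matrix (Fin (n-1)) (Fin (n-1)) ℝ} {lam Lam : ℝ} {I : Set ℝ}
  {x : ℝ → ℝ} {y : ℝ → Fin (n-1) → ℝ} {ξ : ℝ → ℝ} {η : ℝ → Fin (n-1) → ℝ}

lemma GasGiantData.differentiableAt (hA : GasGiantData n ε U A lam Lam) {a : ℝ}
    {b : Fin (n-1) → ℝ} (ha : a ∈ Ico 0 ε) (hb : b ∈ U) (i j : Fin (n-1)) :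
    DifferentiableAt ℝ (fun p : ℝ × (Fin (n-1) → ℝ) => A p.1 p.2 i j) (a, b) := by
  obtain ⟨W, hW, hsub, hs⟩ := hA.hsmooth
  exact ((hs i j).contDiffAt (hW.mem_nhds (hsub ⟨ha, hb⟩))).differentiableAt (by simp)

lemma IsHamTraj.hasDerivAt_energy (hA : GasGiantData n ε U A lam Lam)
    (h : IsHamTraj n ε U A I x y ξ η) {t : ℝ} (ht : t ∈ I) :
    HasDerivAt (fun t => ξ t ^ 2 + x t ^ 2 * quadForm (A (x t) (y t)) (η t) (η t)) 0 t := by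
  obtain ⟨hxm, hym⟩ := h.mem t ht
  set p : Fin (n-1) → ℝ := fun k => ∑ j, A (x t) (y t) k j * η t j with hp
  set q : Fin (n-1) → ℝ := fun k => quadForm (dyA A k (x t) (y t)) (η t) (η t) with hq
  have hM : ∀ i j, HasDerivAt (fun t => A (x t) (y t) i j)
      ((Matrix.of fun i j => ξ t * dxA A (x t) (y t) i j +
        ∑ k, (x t ^ 2 * p k) * dyA A k (x t) (y t) i j) i j) t := fun i j =>
    hasDerivAt_comp_partials (hA.differentiableAt hxm hym i j) (h.hx t ht) (h.hy t ht)
  have hQ := hasDerivAt_quadForm (v := η) hM (h.heta t ht)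
  have hE := ((h.hxi t ht).fun_pow 2).fun_add (((h.hx t ht).fun_pow 2).fun_mul hQ)
  refine hE.congr_deriv ?_
  have h1 : quadForm (Matrix.of fun i j => ξ t * dxA A (x t) (y t) i j +
        ∑ k, (x t ^ 2 * p k) * dyA A k (x t) (y t) i j) (η t) (η t) =
      ξ t * quadForm (dxA A (x t) (y t)) (η t) (η t) + x t ^ 2 * ∑ k, p k * q k := by
    have e : ∑ k, p k * q k =
        ∑ i, ∑ j, ∑ k, p k * dyA A k (x t) (y t) i j * η t j * η t i := by
      simp only [hq, quadForm, Finset.mul_sum, Finset.sum_mul]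
      rw [Finset.sum_comm]
      refine Finset.sum_congr rfl fun i _ => ?_
      rw [Finset.sum_comm]
      refine Finset.sum_congr rfl fun j _ => Finset.sum_congr rfl fun k _ => ?_
      ring
    rw [e]
    simp only [quadForm, Finset.mul_sum, Finset.sum_mul, Matrix.of_apply, add_mul,
      Finset.sum_add_distrib]
    refine congrArg₂ _ ?_ ?_
    · refine Finset.sum_congr rfl fun i _ => Finset.sum_congr rfl fun j _ => ?_
      ring
    · refine Finset.sum_congr rfl fun i _ => Finset.sum_congr rfl fun j _ =>
        Finset.sum_congr rfl fun k _ => ?_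
      ring
  have h2 : quadForm (A (x t) (y t)) (η t) (fun i => -(1/2) * (x t)^2 * q i) =
      -(1/2) * (x t)^2 * ∑ k, p k * q k := by
    simp only [quadForm, Finset.mul_sum]
    refine Finset.sum_congr rfl fun i _ => ?_
    simp only [hp]
    ring
  change _ + (_ + _ * (_ + quadForm (A (x t) (y t)) (fun i => -(1/2) * (x t)^2 * q i) (η t)
    + quadForm (A (x t) (y t)) (η t) (fun i => -(1/2) * (x t)^2 * q i))) = 0
  rw [h1, quadForm_comm (hA.hsymm _ hxm _ hym) (fun i => -(1/2) * (x t)^2 * q i) (η t), h2]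
  push_cast
  ring

/-- Bounds valid on a piece `[0, τ]`, with `τ ≤ P`, of a trajectory starting at the boundary. -/
lemma IsHamTraj.bounds (hA : GasGiantData n ε U A lam Lam) {τ P s : ℝ}
    (h : IsHamTraj n ε U A (Icc 0 τ) x y ξ η) (hx0 : x 0 = 0) (hξ0 : ξ 0 = s)
    (hη0 : quadForm (A 0 (y 0)) (η 0) (η 0) = 1) (hs : 0 < s) (hτP : τ ≤ P)
    (hsmall : (n - 1 : ℕ) * (Lam * (n - 1 : ℕ) / (2 * lam) * s ^ 2 * P) ^ 2 ≤ 1 / (4 * Lam))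
    {t : ℝ} (ht : t ∈ Icc 0 τ) :
    |ξ t| ≤ s ∧ x t ^ 2 * ∑ i, η t i ^ 2 ≤ s ^ 2 / lam ∧
    (∀ i, |η t i - η 0 i| ≤ Lam * (n - 1 : ℕ) / (2 * lam) * s ^ 2 * P) ∧
    1 / (4 * Lam) ≤ ∑ i, η t i ^ 2 ∧ x t ^ 2 ≤ 4 * Lam / lam * s ^ 2 := by
  have hlam := hA.hlam
  have hLam : 0 < Lam := hlam.trans_le hA.hlamLam
  have h0 : (0 : ℝ) ∈ Icc 0 τ := ⟨le_rfl, ht.1.trans ht.2⟩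
  have hen : ∀ u ∈ Icc 0 τ,
      ξ u ^ 2 + x u ^ 2 * quadForm (A (x u) (y u)) (η u) (η u) = s ^ 2 := fun u hu => by
    have := abs_sub_le_of_hasDerivAt (fun v hv => h.hasDerivAt_energy hA hv)
      (fun _ _ => abs_zero.le) hu
    rw [zero_mul, abs_nonpos_iff, sub_eq_zero] at this
    simpa [hx0, hξ0] using this
  have hq : ∀ u ∈ Icc 0 τ, x u ^ 2 * ∑ i, η u i ^ 2 ≤ s ^ 2 / lam := fun u hu => by
    have h1 := (hA.hposdef _ (h.mem u hu).1 _ (h.mem u hu).2 (η u)).1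
    have h2 := mul_le_mul_of_nonneg_left h1 (sq_nonneg (x u))
    rw [le_div_iff₀ hlam]
    nlinarith [hen u hu, sq_nonneg (ξ u)]
  have hη : ∀ i, |η t i - η 0 i| ≤ Lam * (n - 1 : ℕ) / (2 * lam) * s ^ 2 * P := fun i => by
    refine (abs_sub_le_of_hasDerivAt (f := fun u => η u i) (fun u hu => h.heta u hu i)
      (fun u hu => ?_) ht).trans (mul_le_mul_of_nonneg_left (ht.2.trans hτP) (by positivity))
    have h1 := abs_quadForm_le ((hA.hderivBound _ (h.mem u hu).1 _ (h.mem u hu).2).2 i) (η u)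
    rw [abs_mul, abs_mul, abs_neg, abs_of_nonneg (by norm_num : (0 : ℝ) ≤ 1 / 2),
      abs_of_nonneg (sq_nonneg (x u))]
    calc 1 / 2 * x u ^ 2 * |quadForm (dyA A i (x u) (y u)) (η u) (η u)|
        ≤ 1 / 2 * x u ^ 2 * (Lam * (n - 1 : ℕ) * ∑ i, η u i ^ 2) :=
          mul_le_mul_of_nonneg_left h1 (by positivity)
      _ = Lam * (n - 1 : ℕ) / 2 * (x u ^ 2 * ∑ i, η u i ^ 2) := by ring
      _ ≤ Lam * (n - 1 : ℕ) / 2 * (s ^ 2 / lam) :=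
          mul_le_mul_of_nonneg_left (hq u hu) (by positivity)
      _ = Lam * (n - 1 : ℕ) / (2 * lam) * s ^ 2 := by field_simp
  have hlow : 1 / (4 * Lam) ≤ ∑ i, η t i ^ 2 := by
    have h1 := (hA.hposdef _ (h.mem 0 h0).1 _ (h.mem 0 h0).2 (η 0)).2
    rw [hx0, hη0, ← div_le_iff₀' hLam] at h1
    have h2 := half_sum_sq_le hη
    have h3 : 1 / Lam = 4 * (1 / (4 * Lam)) := by field_simp
    linarith
  refine ⟨abs_le_of_sq_le_sq ?_ hs.le, hq t ht, hη, hlow, ?_⟩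
  · have h1 := (hA.hposdef _ (h.mem t ht).1 _ (h.mem t ht).2 (η t)).1
    have h2 : 0 ≤ quadForm (A (x t) (y t)) (η t) (η t) := le_trans (by positivity) h1
    nlinarith [hen t ht, mul_nonneg (sq_nonneg (x t)) h2]
  · have h1 := (mul_le_mul_of_nonneg_left hlow (sq_nonneg (x t))).trans (hq t ht)
    rw [mul_one_div, div_le_iff₀ (by positivity)] at h1
    calc _ ≤ _ := h1
      _ = _ := by ring

lemma IsHamTraj.le_pi_div (hA : GasGiantData n ε U A lam Lam) {T w s : ℝ}
    (h : IsHamTraj n ε U A (Icc 0 T) x y ξ η) (hx0 : x 0 = 0) (hξ0 : ξ 0 = s)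
    (hη0 : quadForm (A 0 (y 0)) (η 0) (η 0) = 1) (hs : 0 < s)
    (hpos : ∀ t ∈ Ioo 0 T, 0 < x t) (hw : 0 < w) (hw2 : w ^ 2 = lam / (8 * Lam))
    (hsmall : (n - 1 : ℕ) * (Lam * (n - 1 : ℕ) / (2 * lam) * s ^ 2 * (Real.pi / w)) ^ 2
      ≤ 1 / (4 * Lam))
    (hsmall' : (Lam * (n - 1 : ℕ)) ^ 2 * (4 * Lam / lam * s ^ 2) ≤ lam ^ 2) :
    T ≤ Real.pi / w := by
  have hlam := hA.hlam
  have hLam : 0 < Lam := hlam.trans_le hA.hlamLam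
  by_contra! hT
  have hsub : Icc 0 (Real.pi / w) ⊆ Icc 0 T := Icc_subset_Icc_right hT.le
  have hh : IsHamTraj n ε U A (Icc 0 (Real.pi / w)) x y ξ η :=
    ⟨fun t ht => h.mem t (hsub ht), fun t ht => h.hx t (hsub ht), fun t ht => h.hy t (hsub ht),
      fun t ht => h.hxi t (hsub ht), fun t ht => h.heta t (hsub ht)⟩
  refine (nonpos_of_deriv_le_neg_sq_mul hw hh.hx hh.hxi hx0 fun t ht => ?_).not_gt
    (hpos _ ⟨div_pos Real.pi_pos hw, hT⟩)
  obtain ⟨-, -, -, hlow, hx2⟩ := hh.bounds hA hx0 hξ0 hη0 hs le_rfl hsmall ht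
  obtain ⟨hxm, hym⟩ := hh.mem t ht
  have hxL : Lam * (n - 1 : ℕ) * x t ≤ lam := by
    refine le_of_sq_le_sq ?_ hlam.le
    rw [mul_pow]
    exact (mul_le_mul_of_nonneg_left hx2 (sq_nonneg _)).trans hsmall'
  have h1 := (hA.hposdef _ hxm _ hym (η t)).1
  have h2 := (abs_le.1 (abs_quadForm_le (hA.hderivBound _ hxm _ hym).1 (η t))).1
  set q := ∑ i, η t i ^ 2 with hqdef
  have hq : 0 ≤ q := Finset.sum_nonneg fun i _ => sq_nonneg _
  have h3 := mul_le_mul_of_nonneg_left h1 hxm.1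
  have h4 := mul_le_mul_of_nonneg_left h2 (by positivity : 0 ≤ 1 / 2 * x t ^ 2)
  have h5 := mul_le_mul_of_nonneg_left hxL (mul_nonneg hxm.1 hq)
  have h6 := mul_le_mul_of_nonneg_left hlow (mul_nonneg hxm.1 hlam.le)
  have h7 : w ^ 2 * x t = x t * lam * (1 / (4 * Lam)) / 2 := by rw [hw2]; field_simp; ring
  linarith

lemma IsHamTraj.abs_y_sub_le (hA : GasGiantData n ε U A lam Lam) {T P B : ℝ}
    (h : IsHamTraj n ε U A (Icc 0 T) x y ξ η) (hTP : T ≤ P)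
    (hB : ∀ t ∈ Icc 0 T, x t ^ 2 * (∑ i, η t i ^ 2 + 1) ≤ B)
    {t : ℝ} (ht : t ∈ Icc 0 T) (i : Fin (n-1)) : |y t i - y 0 i| ≤ Lam / 2 * B * P := by
  have hLam : 0 < Lam := hA.hlam.trans_le hA.hlamLam
  have hB0 : 0 ≤ B := le_trans (by positivity) (hB t ht)
  refine (abs_sub_le_of_hasDerivAt (f := fun u => y u i) (fun u hu => h.hy u hu i)
    (fun u hu => ?_) ht).trans (mul_le_mul_of_nonneg_left (ht.2.trans hTP) (by positivity))
  obtain ⟨hxm, hym⟩ := h.mem u hu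
  have h1 := abs_mulVec_apply_le (hA.hsymm _ hxm _ hym)
    (fun v => le_trans (mul_nonneg hA.hlam.le (Finset.sum_nonneg fun j _ => sq_nonneg (v j)))
      (hA.hposdef _ hxm _ hym v).1)
    (fun v => (hA.hposdef _ hxm _ hym v).2) (η u) i
  rw [abs_mul, abs_of_nonneg (sq_nonneg (x u))]
  calc _ ≤ x u ^ 2 * (Lam / 2 * (∑ j, η u j ^ 2 + 1)) :=
        mul_le_mul_of_nonneg_left h1 (sq_nonneg _)
    _ = Lam / 2 * (x u ^ 2 * (∑ j, η u j ^ 2 + 1)) := by ring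
    _ ≤ Lam / 2 * B := mul_le_mul_of_nonneg_left (hB u hu) (by positivity)

end Trajectory

/-- quantitative estimates along short geodesics: `‖y(t) − y₀‖ ≤ C s²`,
`‖η(t) − η₀‖ ≤ C s²`, `|ξ(t)| ≤ s`, `x(t) ≤ C s`; `ε'`, `C` depend only on `n`, `lam`, `Lam`. -/
theorem stmt_10 (n : ℕ) (hn : 2 ≤ n) (lam Lam : ℝ) (hlam : 0 < lam) (hll : lam ≤ Lam) :
    ∃ ε' > (0:ℝ), ∃ C > (0:ℝ),
      ∀ (ε : ℝ) (U : Set (Fin (n-1) → ℝ))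
        (A : ℝ → (Fin (n-1) → ℝ) → Matrix (Fin (n-1)) (Fin (n-1)) ℝ),
        GasGiantData n ε U A lam Lam →
        ∀ (y₀ η₀ : Fin (n-1) → ℝ) (s T : ℝ)
          (x : ℝ → ℝ) (y : ℝ → Fin (n-1) → ℝ) (ξ : ℝ → ℝ) (η : ℝ → Fin (n-1) → ℝ),
          y₀ ∈ U → quadForm (A 0 y₀) η₀ η₀ = 1 → 0 < s → s < ε' →
          IsShortGeo n ε U A y₀ η₀ s T x y ξ η →
          ∀ t ∈ Set.Icc (0:ℝ) T,
            euclNorm (fun i => y t i - y₀ i) ≤ C * s^2 ∧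
            euclNorm (fun i => η t i - η₀ i) ≤ C * s^2 ∧
            |ξ t| ≤ s ∧ x t ≤ C * s := by
  have hLam : 0 < Lam := hlam.trans_le hll
  set m : ℝ := ((n - 1 : ℕ) : ℝ)
  have hm0 : 0 ≤ m := Nat.cast_nonneg _
  set w : ℝ := Real.sqrt (lam / (8 * Lam)) with hwdef
  have hw : 0 < w := Real.sqrt_pos.2 (by positivity)
  have hw2 : w ^ 2 = lam / (8 * Lam) := Real.sq_sqrt (by positivity)
  set P : ℝ := Real.pi / w with hPdef
  have hP : 0 < P := div_pos Real.pi_pos hw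
  set K : ℝ := Lam * m / (2 * lam) * P with hK
  have hK0 : 0 ≤ K := by positivity
  set D : ℝ := (Lam * m) ^ 2 * (4 * Lam / lam) with hD
  have hD0 : 0 ≤ D := by positivity
  set B : ℝ := 1 / lam + 4 * Lam / lam with hBdef
  have hB0 : 0 < B := by positivity
  set G : ℝ := 4 * Lam * (m * K ^ 2) + D / lam ^ 2 + 1 with hG
  have hG1 : 1 ≤ G := by
    have : 0 ≤ 4 * Lam * (m * K ^ 2) + D / lam ^ 2 := by positivity
    linarith
  refine ⟨1 / G, by positivity,
    m * (Lam / 2 * B * P) + m * K + Real.sqrt (4 * Lam / lam), by positivity, ?_⟩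
  rintro ε U A hA y₀ η₀ s T x y ξ η - hη0 hs hsε ⟨hT, h, hx0, rfl, hξ0, rfl, -, hpos⟩ t ht
  have hsG : s * G ≤ 1 := ((lt_div_iff₀ (by positivity)).1 hsε).le
  have hs1 : s ≤ 1 := by nlinarith
  have hsm : s * (m * K ^ 2) ≤ 1 / (4 * Lam) ∧ s * D ≤ lam ^ 2 := by
    have e1 : 0 ≤ s * (4 * Lam * (m * K ^ 2)) := by positivity
    have e2 : 0 ≤ s * (D / lam ^ 2) := by positivity
    have e3 : s * (4 * Lam * (m * K ^ 2)) + s * (D / lam ^ 2) + s ≤ 1 := by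
      calc _ = s * G := by rw [hG]; ring
        _ ≤ 1 := hsG
    constructor
    · rw [le_div_iff₀ (by positivity)]; linarith
    · have : s * D / lam ^ 2 ≤ 1 := by rw [mul_div_assoc]; linarith
      rwa [div_le_one (by positivity)] at this
  have hs2 : s ^ 2 ≤ s := by nlinarith
  have hs4 : s ^ 4 ≤ s := by nlinarith [sq_nonneg s]
  have hsmall : m * (Lam * m / (2 * lam) * s ^ 2 * P) ^ 2 ≤ 1 / (4 * Lam) := by
    calc _ = s ^ 4 * (m * K ^ 2) := by rw [hK]; ring
      _ ≤ s * (m * K ^ 2) := mul_le_mul_of_nonneg_right hs4 (by positivity)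
      _ ≤ _ := hsm.1
  have hsmall' : (Lam * m) ^ 2 * (4 * Lam / lam * s ^ 2) ≤ lam ^ 2 := by
    calc _ = s ^ 2 * D := by rw [hD]; ring
      _ ≤ s * D := mul_le_mul_of_nonneg_right hs2 hD0
      _ ≤ _ := hsm.2
  have hTP : T ≤ P := h.le_pi_div hA hx0 hξ0 hη0 hs hpos hw hw2 hsmall hsmall'
  have hb := fun u (hu : u ∈ Icc 0 T) => h.bounds hA hx0 hξ0 hη0 hs hTP hsmall hu
  have hy := h.abs_y_sub_le hA (B := B * s ^ 2) hTP (fun u hu => by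
    obtain ⟨-, h1, -, -, h2⟩ := hb u hu
    have e : B * s ^ 2 = s ^ 2 / lam + 4 * Lam / lam * s ^ 2 := by rw [hBdef]; ring
    linarith) ht
  obtain ⟨hξ, -, hη, -, hx⟩ := hb t ht
  have c1 : 0 ≤ m * (Lam / 2 * B * P) := by positivity
  have c2 : 0 ≤ m * K := by positivity
  have c3 := Real.sqrt_nonneg (4 * Lam / lam)
  refine ⟨?_, ?_, hξ, ?_⟩
  · calc _ ≤ m * (Lam / 2 * (B * s ^ 2) * P) := euclNorm_le_of_abs_le (by positivity) hy
      _ = m * (Lam / 2 * B * P) * s ^ 2 := by ring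
      _ ≤ _ := mul_le_mul_of_nonneg_right (by linarith) (sq_nonneg s)
  · calc _ ≤ m * (Lam * m / (2 * lam) * s ^ 2 * P) := euclNorm_le_of_abs_le (by positivity) hη
      _ = m * K * s ^ 2 := by rw [hK]; ring
      _ ≤ _ := mul_le_mul_of_nonneg_right (by linarith) (sq_nonneg s)
  · calc x t ≤ Real.sqrt (4 * Lam / lam) * s := by
          refine le_of_sq_le_sq ?_ (by positivity)
          rwa [mul_pow, Real.sq_sqrt (by positivity)]
      _ ≤ _ := mul_le_mul_of_nonneg_right (by linarith) hs.le
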